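/- arXiv:2603.07844 — 2 statements merged into one kernel-verified Lean document; each statement's English description precedes it below -/
import Mathlib

section
/- In a deterministic planning problem, if G* x < ⊤, then there exist K < Fintype.card X and an action sequence a : ℕ → U such that traj x a K ∈ G and (cost x a K : ℝ≥0∞) = G* x; that is, the optimal cost-to-go, when finite, is attained by a goal-reaching plan of fewer than |X| steps. -/
open scoped NNReal ENNReal

variable {X U : Type*}

/-- Trajectory of an action sequence `a` from state `x` under transition function `f`. -/
def traj (f : X → U → X) (x : X) (a : ℕ → U) : ℕ → X
  | 0 => x
  | k + 1 => f (traj f x a k) (a k)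

/-- The `K`-stage cost of the action sequence `a` from `x`. -/
def cost (f : X → U → X) (ℓ : X → U → ℝ≥0) (x : X) (a : ℕ → U) (K : ℕ) : ℝ≥0 :=
  ∑ k ∈ Finset.range K, ℓ (traj f x a k) (a k)

/-- The optimal cost-to-go: infimum of cost over all goal-reaching plans (⊤ if none). -/
noncomputable def Gstar (f : X → U → X) (ℓ : X → U → ℝ≥0) (G : Set X) (x : X) : ℝ≥0∞ :=
  ⨅ (K : ℕ) (a : ℕ → U) (_ : traj f x a K ∈ G), (cost f ℓ x a K : ℝ≥0∞)

theorem traj_congr (f : X → U → X) (x : X) {a b : ℕ → U} {K : ℕ}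
    (hab : ∀ k < K, a k = b k) : traj f x a K = traj f x b K := by
  induction K with
  | zero => rfl
  | succ K ih =>
    simp only [traj, ih fun k hk => hab k (hk.trans K.lt_succ_self), hab K K.lt_succ_self]

theorem cost_congr (f : X → U → X) (ℓ : X → U → ℝ≥0) (x : X) {a b : ℕ → U} {K : ℕ}
    (hab : ∀ k < K, a k = b k) : cost f ℓ x a K = cost f ℓ x b K := by
  refine Finset.sum_congr rfl fun k hk => ?_
  have hk := Finset.mem_range.1 hk
  rw [traj_congr f x fun j hj => hab j (hj.trans hk), hab k hk]

theorem traj_add (f : X → U → X) (x : X) (a : ℕ → U) (i m : ℕ) :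
    traj f x a (i + m) = traj f (traj f x a i) (fun k => a (i + k)) m := by
  induction m with
  | zero => rfl
  | succ m ih => rw [← Nat.add_assoc, traj, traj, ih]

theorem cost_add (f : X → U → X) (ℓ : X → U → ℝ≥0) (x : X) (a : ℕ → U) (i m : ℕ) :
    cost f ℓ x a (i + m) =
      cost f ℓ x a i + cost f ℓ (traj f x a i) (fun k => a (i + k)) m := by
  simp only [cost, Finset.sum_range_add, traj_add]

/-- Cutting a cycle out of a trajectory keeps its endpoint and does not increase its cost. -/
theorem exists_cost_le_of_cycle (f : X → U → X) (ℓ : X → U → ℝ≥0) (x : X) (a : ℕ → U)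
    (i d m : ℕ) (hcycle : traj f x a (i + d) = traj f x a i) :
    ∃ b : ℕ → U, traj f x b (i + m) = traj f x a (i + d + m) ∧
      cost f ℓ x b (i + m) ≤ cost f ℓ x a (i + d + m) := by
  let b : ℕ → U := fun k => if k < i then a k else a (d + k)
  have hb : ∀ k < i, b k = a k := fun k hk => if_pos hk
  have hshift : (fun k => b (i + k)) = fun k => a (i + d + k) := by
    funext k
    simp only [b, if_neg (Nat.not_lt.2 (Nat.le_add_right i k))]
    congr 1
    omega
  refine ⟨b, ?_, ?_⟩
  · rw [traj_add, traj_add f x a, hcycle, traj_congr f x hb, hshift]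
  · rw [cost_add, cost_add f ℓ x a (i + d), hcycle, traj_congr f x hb, cost_congr f ℓ x hb, hshift,
      cost_add f ℓ x a i d]
    gcongr
    exact le_self_add

/-- Every plan can be shortened to fewer than `|X|` steps without increasing its cost. -/
theorem exists_short_plan [Fintype X] (f : X → U → X) (ℓ : X → U → ℝ≥0) (x : X) (K : ℕ)
    (a : ℕ → U) :
    ∃ L < Fintype.card X, ∃ b : ℕ → U,
      traj f x b L = traj f x a K ∧ cost f ℓ x b L ≤ cost f ℓ x a K := by
  induction K using Nat.strong_induction_on generalizing a with
  | _ K ih =>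
    by_cases hK : K < Fintype.card X
    · exact ⟨K, hK, a, rfl, le_rfl⟩
    · obtain ⟨i, j, hij, heq⟩ : ∃ i j : Fin (K + 1), i < j ∧ traj f x a i = traj f x a j := by
        obtain ⟨i, j, hne, heq⟩ := Fintype.exists_ne_map_eq_of_card_lt
          (fun k : Fin (K + 1) => traj f x a k) (by rw [Fintype.card_fin]; omega)
        rcases lt_or_gt_of_ne hne with h | h
        · exact ⟨i, j, h, heq⟩
        · exact ⟨j, i, h, heq.symm⟩
      have hij : (i : ℕ) < j := hij
      have hj := j.is_lt
      obtain ⟨d, hd⟩ := Nat.exists_eq_add_of_lt hij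
      obtain ⟨m, hm⟩ := Nat.exists_eq_add_of_le (Nat.le_of_lt_succ hj)
      obtain ⟨b, hb, hbc⟩ := exists_cost_le_of_cycle f ℓ x a i (d + 1) m
        (by rw [← Nat.add_assoc, ← hd, heq])
      rw [← Nat.add_assoc, ← hd, ← hm] at hb hbc
      obtain ⟨L, hL, c, hc, hcc⟩ := ih (i + m) (by omega) b
      exact ⟨L, hL, c, hc.trans hb, hcc.trans hbc⟩

/-- If some plan reaches `G`, then among all plans reaching `G` there is a cheapest one, and it can
be taken to have fewer than `|X|` steps. -/
theorem exists_optimal_plan [Fintype X] [Finite U] (f : X → U → X) (ℓ : X → U → ℝ≥0)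
    (G : Set X) (x : X) (hG : ∃ (K : ℕ) (a : ℕ → U), traj f x a K ∈ G) :
    ∃ K < Fintype.card X, ∃ a : ℕ → U, traj f x a K ∈ G ∧
      ∀ (L : ℕ) (b : ℕ → U), traj f x b L ∈ G → cost f ℓ x a K ≤ cost f ℓ x b L := by
  obtain ⟨K₀, a₀, h₀⟩ := hG
  let ext : (Fin (Fintype.card X) → U) → ℕ → U :=
    fun v k => if hk : k < Fintype.card X then v ⟨k, hk⟩ else a₀ k
  let S : Set (Fin (Fintype.card X) × (Fin (Fintype.card X) → U)) :=
    {p | traj f x (ext p.2) p.1 ∈ G}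
  have key : ∀ (L : ℕ) (b : ℕ → U), traj f x b L ∈ G →
      ∃ p ∈ S, cost f ℓ x (ext p.2) p.1 ≤ cost f ℓ x b L := by
    intro L b hb
    obtain ⟨M, hM, c, hc, hcc⟩ := exists_short_plan f ℓ x L b
    have hext : ∀ k < M, ext (fun k => c k) k = c k := fun k hk => dif_pos (hk.trans hM)
    refine ⟨(⟨M, hM⟩, fun k => c k), ?_, ?_⟩
    · change traj f x (ext fun k => c k) M ∈ G
      rwa [traj_congr f x hext, hc]
    · change cost f ℓ x (ext fun k => c k) M ≤ _
      rwa [cost_congr f ℓ x hext]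
  obtain ⟨p₀, hp₀, -⟩ := key K₀ a₀ h₀
  obtain ⟨p, hp, hmin⟩ := Set.exists_min_image S (fun p => cost f ℓ x (ext p.2) p.1)
    S.toFinite ⟨p₀, hp₀⟩
  refine ⟨p.1, p.1.is_lt, ext p.2, hp, fun L b hb => ?_⟩
  obtain ⟨q, hq, hqb⟩ := key L b hb
  exact (hmin q hq).trans hqb

/-- If the optimal cost-to-go is finite, it is attained by a goal-reaching plan of
fewer than `|X|` steps. -/
theorem Gstar_attained [Fintype X] [Fintype U] [Nonempty U]
    (f : X → U → X) (ℓ : X → U → ℝ≥0) (G : Set X)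
    (x : X) (h : Gstar f ℓ G x < ⊤) :
    ∃ K < Fintype.card X, ∃ a : ℕ → U,
      traj f x a K ∈ G ∧ (cost f ℓ x a K : ℝ≥0∞) = Gstar f ℓ G x := by
  have hG : ∃ (K : ℕ) (a : ℕ → U), traj f x a K ∈ G := by
    simp only [Gstar, iInf_lt_iff] at h
    obtain ⟨K, a, ha, -⟩ := h
    exact ⟨K, a, ha⟩
  obtain ⟨K, hK, a, ha, hmin⟩ := exists_optimal_plan f ℓ G x hG
  refine ⟨K, hK, a, ha, le_antisymm ?_ ?_⟩
  · exact le_iInf fun L => le_iInf fun b => le_iInf fun hb => by exact_mod_cast hmin L b hb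
  · exact iInf_le_of_le K (iInf_le_of_le a (iInf_le _ ha))
end

section
/- In a deterministic planning problem in which ℓ x u > 0 for every x ∉ G and every u : U, there exists a feedback plan π : X → U with the following property: for every state x with G* x < ⊤, writing g : X → X for the closed-loop map g y = f y (π y), there exists K : ℕ such that g^[K] x ∈ G and (∑_{k < K} ℓ (g^[k] x) (π (g^[k] x)) : ℝ≥0∞) = G* x. In other words, an optimal feedback plan exists: executing it from any state with finite optimal cost-to-go reaches the goal with total cost exactly G* x. -/
open scoped NNReal ENNReal

variable {X U : Type*}

theorem traj_succ_eq_traj_tail (f : X → U → X) (x : X) (a : ℕ → U) (k : ℕ) :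
    traj f x a (k + 1) = traj f (f x (a 0)) (fun n => a (n + 1)) k := by
  induction k with
  | zero => rfl
  | succ k ih => rw [traj, ih, traj]

theorem cost_succ_eq_add_cost_tail (f : X → U → X) (ℓ : X → U → ℝ≥0) (x : X) (a : ℕ → U) (K : ℕ) :
    cost f ℓ x a (K + 1) = ℓ x (a 0) + cost f ℓ (f x (a 0)) (fun n => a (n + 1)) K := by
  simp only [cost, Finset.sum_range_succ', traj_succ_eq_traj_tail]
  exact add_comm _ _

theorem Gstar_le_cost {f : X → U → X} (ℓ : X → U → ℝ≥0) {G : Set X} {x : X} {a : ℕ → U} {K : ℕ}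
    (h : traj f x a K ∈ G) : Gstar f ℓ G x ≤ cost f ℓ x a K :=
  iInf_le_of_le K (iInf_le_of_le a (iInf_le _ h))

theorem traj_feedback (f : X → U → X) (π : X → U) (x : X) (k : ℕ) :
    traj f x (fun n => π ((fun y => f y (π y))^[n] x)) k = (fun y => f y (π y))^[k] x := by
  induction k with
  | zero => rfl
  | succ k ih => rw [traj, ih, Function.iterate_succ_apply']

/-- A greedy action does not increase stage cost plus cost-to-go: the inequality of Bellman's
equation that is needed off the goal. -/
theorem exists_add_Gstar_le [Finite U] [Nonempty U] (f : X → U → X) (ℓ : X → U → ℝ≥0)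
    {G : Set X} {x : X} (hx : x ∉ G) : ∃ u, ℓ x u + Gstar f ℓ G (f x u) ≤ Gstar f ℓ G x := by
  obtain ⟨u, hu⟩ := Finite.exists_min fun u => (ℓ x u : ℝ≥0∞) + Gstar f ℓ G (f x u)
  refine ⟨u, le_iInf fun K => le_iInf fun a => le_iInf fun h => ?_⟩
  cases K with
  | zero => exact absurd h hx
  | succ K =>
    rw [traj_succ_eq_traj_tail] at h
    rw [cost_succ_eq_add_cost_tail, ENNReal.coe_add]
    exact (hu (a 0)).trans (add_le_add_right (Gstar_le_cost ℓ h) _)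

/-- Following a greedy policy from a state of finite cost-to-go reaches the goal at cost at most
`Gstar`, since `Gstar` strictly decreases along the way and there are finitely many states. -/
theorem exists_feedback_cost_le [Finite X] {f : X → U → X} {ℓ : X → U → ℝ≥0} {G : Set X}
    (hpos : ∀ x ∉ G, ∀ u : U, 0 < ℓ x u) {π : X → U}
    (hπ : ∀ x ∉ G, ℓ x (π x) + Gstar f ℓ G (f x (π x)) ≤ Gstar f ℓ G x)
    (x : X) (hx : Gstar f ℓ G x < ⊤) :
    ∃ K : ℕ, (fun y => f y (π y))^[K] x ∈ G ∧
      ((∑ k ∈ Finset.range K,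
          ℓ ((fun y => f y (π y))^[k] x) (π ((fun y => f y (π y))^[k] x)) : ℝ≥0) : ℝ≥0∞)
        ≤ Gstar f ℓ G x := by
  have hwf : WellFounded fun y z : X => Gstar f ℓ G y < Gstar f ℓ G z :=
    @Finite.wellFounded_of_trans_of_irrefl X _ _ ⟨fun _ _ _ => lt_trans⟩ ⟨fun _ => lt_irrefl _⟩
  induction x using hwf.induction with
  | _ x ih =>
    by_cases hG : x ∈ G
    · exact ⟨0, hG, by simp⟩
    have hfin : Gstar f ℓ G (f x (π x)) < ⊤ := (le_add_self.trans (hπ x hG)).trans_lt hx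
    have hlt : Gstar f ℓ G (f x (π x)) < Gstar f ℓ G x := by
      refine lt_of_lt_of_le ?_ (hπ x hG)
      rw [add_comm]
      exact ENNReal.lt_add_right hfin.ne (by exact_mod_cast (hpos x hG (π x)).ne')
    obtain ⟨K, hK, hc⟩ := ih _ hlt hfin
    refine ⟨K + 1, hK, ?_⟩
    rw [Finset.sum_range_succ', add_comm, ENNReal.coe_add]
    exact (add_le_add_right hc _).trans (hπ x hG)

/-- Existence of an optimal feedback plan: when all stage costs off the goal are
positive, there is a single policy `π` that, from every state with finite optimal
cost-to-go, reaches the goal with total cost exactly `G*`. -/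
theorem exists_optimal_feedback_plan [Fintype X] [Fintype U] [Nonempty U]
    (f : X → U → X) (ℓ : X → U → ℝ≥0) (G : Set X)
    (hpos : ∀ x ∉ G, ∀ u : U, 0 < ℓ x u) :
    ∃ π : X → U, ∀ x : X, Gstar f ℓ G x < ⊤ →
      ∃ K : ℕ, (fun y => f y (π y))^[K] x ∈ G ∧
        ((∑ k ∈ Finset.range K,
            ℓ ((fun y => f y (π y))^[k] x) (π ((fun y => f y (π y))^[k] x)) : ℝ≥0) : ℝ≥0∞)
          = Gstar f ℓ G x := by
  choose! π hπ using fun x (hx : x ∉ G) => exists_add_Gstar_le f ℓ hx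
  refine ⟨π, fun x hx => ?_⟩
  obtain ⟨K, hK, hc⟩ := exists_feedback_cost_le hpos hπ x hx
  refine ⟨K, hK, hc.antisymm ?_⟩
  have h := Gstar_le_cost ℓ ((traj_feedback f π x K).symm ▸ hK)
  simpa only [cost, traj_feedback] using h
end
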